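/- Let A be a bialgebra and M, N left-right Yetter-Drinfel'd modules. Define the vertical coface maps c_i^{n,p}: Y^{n,p}(M,N) → Y^{n,p+1}(M,N) for 0 ≤ i ≤ p+1 by: c_0(f)(a^1⊗...⊗a^n⊗m) = Σ (f((a^1)_2⊗...⊗(a^n)_2⊗m)^0)_0 ⊗ (f(...)^0)_1 (a^1)_1...(a^n)_1 ⊗ f(...)^1 ⊗ ... ⊗ f(...)^p, c_i(f) applies Δ to the i-th A-output for 1 ≤ i ≤ p, and c_{p+1}(f)(a^1⊗...⊗a^n⊗m) = Σ f((a^1)_1⊗...⊗(a^n)_1⊗m_0) ⊗ (a^1)_2...(a^n)_2 m_1. Then for all 0 ≤ i < j ≤ p+2, c_j^{n,p+1} ∘ c_i^{n,p} = c_i^{n,p+1} ∘ c_{j-1}^{n,p}, and consequently d_c^{n,p} = Σ_{i=0}^{p+1} (-1)^i c_i^{n,p} satisfies d_c^{n,p+1} ∘ d_c^{n,p} = 0. -/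

import Mathlib

open TensorProduct
noncomputable section

namespace PS

variable (k : Type) [Field k] (A : Type) [Ring A] [Bialgebra k A]

/-- Left-nested tensor powers with base `B`: `pwr B n = B ⊗ A ⊗ ⋯ ⊗ A` (`n` copies of `A`). -/
def pwr (B : ModuleCat k) : ℕ → ModuleCat k
  | 0 => B
  | n + 1 => ModuleCat.of k (pwr B n ⊗[k] A)

/-- `A^{⊗ n}` realized as `pwr k n`, i.e. `k ⊗ A ⊗ ⋯ ⊗ A`. -/
abbrev Pk (n : ℕ) : ModuleCat k := pwr k A (ModuleCat.of k k) n

abbrev μA : A ⊗[k] A →ₗ[k] A := LinearMap.mul' k A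
abbrev ΔA : A →ₗ[k] A ⊗[k] A := Coalgebra.comul
abbrev εA : A →ₗ[k] k := Coalgebra.counit

/-- Multiplication of the tensorands in slots `i` and `i+1` (`1 ≤ i ≤ n`);
junk (zero map) for other `i`. -/
def mulP : (n : ℕ) → (i : ℕ) → ((Pk k A (n+1) : Type) →ₗ[k] Pk k A n)
  | 0, _ => 0
  | n + 1, i =>
      if i = n + 1 then
        (TensorProduct.map (LinearMap.id : (Pk k A n : Type) →ₗ[k] Pk k A n) (μA k A)).comp
          (TensorProduct.assoc k (Pk k A n) A A).toLinearMap
      else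
        TensorProduct.map (mulP n i) (LinearMap.id : A →ₗ[k] A)

/-- Insert an `A`-factor at the innermost slot (slot 1). -/
def insP : (n : ℕ) → (A ⊗[k] (Pk k A n : Type)) ≃ₗ[k] (Pk k A (n+1) : Type)
  | 0 => TensorProduct.comm k A k
  | n + 1 =>
      (TensorProduct.assoc k A (Pk k A n) A).symm.trans
        (TensorProduct.congr (insP n) (LinearEquiv.refl k A))

section NM

variable {N : Type} [AddCommGroup N] [Module k N]

/-- The left diagonal action of `A` on `N ⊗ A^{⊗ p}` built from a base action `ωN`. -/
def ldiag (ωN : A ⊗[k] N →ₗ[k] N) :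
    (p : ℕ) → (A ⊗[k] (pwr k A (ModuleCat.of k N) p : Type) →ₗ[k] pwr k A (ModuleCat.of k N) p)
  | 0 => ωN
  | p + 1 =>
      (TensorProduct.map (ldiag ωN p) (μA k A)).comp <|
        ((TensorProduct.tensorTensorTensorComm k A A
            (pwr k A (ModuleCat.of k N) p : Type) A).toLinearMap).comp
          (TensorProduct.map (ΔA k A) (LinearMap.id :
            ((pwr k A (ModuleCat.of k N) p : Type) ⊗[k] A) →ₗ[k] _))

/-- Right diagonal multiplication on the `A`-slots of `N ⊗ A^{⊗ p}` (counit on the base). -/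
def rdiagE : (p : ℕ) →
    ((pwr k A (ModuleCat.of k N) p : Type) ⊗[k] A →ₗ[k] pwr k A (ModuleCat.of k N) p)
  | 0 => (TensorProduct.rid k N).toLinearMap.comp
      (TensorProduct.map (LinearMap.id : N →ₗ[k] N) (εA k A))
  | p + 1 =>
      (TensorProduct.map (rdiagE p) (μA k A)).comp <|
        ((TensorProduct.tensorTensorTensorComm k
            (pwr k A (ModuleCat.of k N) p : Type) A A A).toLinearMap).comp
          (TensorProduct.map
            (LinearMap.id : ((pwr k A (ModuleCat.of k N) p : Type) ⊗[k] A) →ₗ[k] _) (ΔA k A))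

/-- Right diagonal action on `N ⊗ A^{⊗ p}` built from a base (right) action `ωNr`. -/
def rdiagAct (ωNr : N ⊗[k] A →ₗ[k] N) : (p : ℕ) →
    ((pwr k A (ModuleCat.of k N) p : Type) ⊗[k] A →ₗ[k] pwr k A (ModuleCat.of k N) p)
  | 0 => ωNr
  | p + 1 =>
      (TensorProduct.map (rdiagAct ωNr p) (μA k A)).comp <|
        ((TensorProduct.tensorTensorTensorComm k
            (pwr k A (ModuleCat.of k N) p : Type) A A A).toLinearMap).comp
          (TensorProduct.map
            (LinearMap.id : ((pwr k A (ModuleCat.of k N) p : Type) ⊗[k] A) →ₗ[k] _) (ΔA k A))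

end NM

/-- `dL : A^{⊗ n} → A ⊗ A^{⊗ n}`, `a^1 ⊗ ⋯ ⊗ a^n ↦ Σ (a^1)_1 ⋯ (a^n)_1 ⊗ ((a^1)_2 ⊗ ⋯ ⊗ (a^n)_2)`. -/
def dL : (n : ℕ) → ((Pk k A n : Type) →ₗ[k] A ⊗[k] (Pk k A n : Type))
  | 0 => (TensorProduct.map (Algebra.linearMap k A) (LinearMap.id : k →ₗ[k] k)).comp
      (TensorProduct.lid k k).symm.toLinearMap
  | n + 1 =>
      (TensorProduct.map (μA k A)
          (LinearMap.id : ((Pk k A n : Type) ⊗[k] A) →ₗ[k] _)).comp <|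
        ((TensorProduct.tensorTensorTensorComm k A (Pk k A n : Type) A A).toLinearMap).comp
          (TensorProduct.map (dL n) (ΔA k A))

/-- `dR : A^{⊗ n} → A^{⊗ n} ⊗ A`, `a^1 ⊗ ⋯ ⊗ a^n ↦ Σ ((a^1)_1 ⊗ ⋯ ⊗ (a^n)_1) ⊗ (a^1)_2 ⋯ (a^n)_2`. -/
def dR : (n : ℕ) → ((Pk k A n : Type) →ₗ[k] (Pk k A n : Type) ⊗[k] A)
  | 0 => (TensorProduct.map (LinearMap.id : k →ₗ[k] k) (Algebra.linearMap k A)).comp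
      (TensorProduct.rid k k).symm.toLinearMap
  | n + 1 =>
      (TensorProduct.map
          (LinearMap.id : ((Pk k A n : Type) ⊗[k] A) →ₗ[k] _) (μA k A)).comp <|
        ((TensorProduct.tensorTensorTensorComm k (Pk k A n : Type) A A A).toLinearMap).comp
          (TensorProduct.map (dR n) (ΔA k A))

section Base

variable {N : Type} [AddCommGroup N] [Module k N]

/-- Apply `ρN : N → N ⊗ A` to the base of `N ⊗ A^{⊗ p}`. -/
def rhoBase (ρN : N →ₗ[k] N ⊗[k] A) : (p : ℕ) →
    ((pwr k A (ModuleCat.of k N) p : Type) →ₗ[k] pwr k A (ModuleCat.of k (N ⊗[k] A)) p)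
  | 0 => ρN
  | p + 1 => TensorProduct.map (rhoBase ρN p) (LinearMap.id : A →ₗ[k] A)

/-- Reinterpret `(N ⊗ A) ⊗ A^{⊗ p}` as `N ⊗ A^{⊗ (p+1)}`. -/
def shiftB : (p : ℕ) →
    ((pwr k A (ModuleCat.of k (N ⊗[k] A)) p : Type) ≃ₗ[k] pwr k A (ModuleCat.of k N) (p+1))
  | 0 => LinearEquiv.refl k (N ⊗[k] A)
  | p + 1 => TensorProduct.congr (shiftB p) (LinearEquiv.refl k A)

/-- Multiply the `A`-component of the base `N ⊗ A` on the right by an element of `A`. -/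
def rmulBase : (p : ℕ) →
    ((pwr k A (ModuleCat.of k (N ⊗[k] A)) p : Type) ⊗[k] A →ₗ[k]
      pwr k A (ModuleCat.of k (N ⊗[k] A)) p)
  | 0 => (TensorProduct.map (LinearMap.id : N →ₗ[k] N) (μA k A)).comp
      (TensorProduct.assoc k N A A).toLinearMap
  | p + 1 =>
      (TensorProduct.map (rmulBase p) (LinearMap.id : A →ₗ[k] A)).comp <|
        ((TensorProduct.assoc k (pwr k A (ModuleCat.of k (N ⊗[k] A)) p : Type) A A).symm.toLinearMap).comp <|
          (TensorProduct.map
            (LinearMap.id : (pwr k A (ModuleCat.of k (N ⊗[k] A)) p : Type) →ₗ[k] _)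
            (TensorProduct.comm k A A).toLinearMap).comp
            (TensorProduct.assoc k
              (pwr k A (ModuleCat.of k (N ⊗[k] A)) p : Type) A A).toLinearMap

/-- Apply the counit to the `A`-component of the base `N ⊗ A`. -/
def epsBase : (p : ℕ) →
    ((pwr k A (ModuleCat.of k (N ⊗[k] A)) p : Type) →ₗ[k] pwr k A (ModuleCat.of k N) p)
  | 0 => (TensorProduct.rid k N).toLinearMap.comp
      (TensorProduct.map (LinearMap.id : N →ₗ[k] N) (εA k A))
  | p + 1 => TensorProduct.map (epsBase p) (LinearMap.id : A →ₗ[k] A)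

/-- Apply `Δ` on the `i`-th `A`-slot (`1 ≤ i ≤ p`) of `N ⊗ A^{⊗ p}`; junk otherwise. -/
def comulAt : (p : ℕ) → (i : ℕ) →
    ((pwr k A (ModuleCat.of k N) p : Type) →ₗ[k] pwr k A (ModuleCat.of k N) (p+1))
  | 0, _ => 0
  | p + 1, i =>
      if i = p + 1 then
        ((TensorProduct.assoc k (pwr k A (ModuleCat.of k N) p : Type) A A).symm.toLinearMap).comp
          (TensorProduct.map
            (LinearMap.id : (pwr k A (ModuleCat.of k N) p : Type) →ₗ[k] _) (ΔA k A))
      else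
        TensorProduct.map (comulAt p i) (LinearMap.id : A →ₗ[k] A)

/-- Left coaction on `N ⊗ A^{⊗ p}` coming from a left coaction on the base. -/
def lcoBase (ρNl : N →ₗ[k] A ⊗[k] N) : (p : ℕ) →
    ((pwr k A (ModuleCat.of k N) p : Type) →ₗ[k]
      A ⊗[k] (pwr k A (ModuleCat.of k N) p : Type))
  | 0 => ρNl
  | p + 1 =>
      ((TensorProduct.assoc k A (pwr k A (ModuleCat.of k N) p : Type) A).toLinearMap).comp
        (TensorProduct.map (lcoBase ρNl p) (LinearMap.id : A →ₗ[k] A))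

end Base

section Bicomplex

variable {M N : Type} [AddCommGroup M] [Module k M] [AddCommGroup N] [Module k N]

/-- `A^{⊗ n} ⊗ M`, the domain of the `(n,p)` cochains. -/
abbrev Dm (M : Type) [AddCommGroup M] [Module k M] (n : ℕ) : Type :=
  (Pk k A n : Type) ⊗[k] M

/-- `N ⊗ A^{⊗ p}`. -/
abbrev Cd (N : Type) [AddCommGroup N] [Module k N] (p : ℕ) : Type :=
  (pwr k A (ModuleCat.of k N) p : Type)

/-- The space of `(n,p)` cochains `Hom(A^{⊗ n} ⊗ M, N ⊗ A^{⊗ p})`. -/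
abbrev Yc (M N : Type) [AddCommGroup M] [Module k M] [AddCommGroup N] [Module k N]
    (n p : ℕ) : Type := Dm k A M n →ₗ[k] Cd k A N p

variable (ωM : A ⊗[k] M →ₗ[k] M) (ρM : M →ₗ[k] M ⊗[k] A)
variable (ωN : A ⊗[k] N →ₗ[k] N) (ρN : N →ₗ[k] N ⊗[k] A)

/-- `b_0`: the face using the diagonal left action of `a^1` on `N ⊗ A^{⊗ p}`. -/
def face0 (n p : ℕ) (f : Yc k A M N n p) : Yc k A M N (n+1) p :=
  (ldiag k A ωN p).comp <|
    (TensorProduct.map (LinearMap.id : A →ₗ[k] A) f).comp <|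
      ((TensorProduct.assoc k A (Pk k A n : Type) M).toLinearMap).comp
        (TensorProduct.map (insP k A n).symm.toLinearMap (LinearMap.id : M →ₗ[k] M))

/-- `b_i`, `1 ≤ i ≤ n`: multiply the adjacent arguments `a^i a^{i+1}`. -/
def faceMid (n p : ℕ) (i : ℕ) (f : Yc k A M N n p) : Yc k A M N (n+1) p :=
  f.comp (TensorProduct.map (mulP k A n i) (LinearMap.id : M →ₗ[k] M))

/-- `b_{n+1}` in the Hopf-module case: `f(a^1 ⊗ ⋯ ⊗ a^n ⊗ a^{n+1}·m)`. -/
def faceLastH (n p : ℕ) (f : Yc k A M N n p) : Yc k A M N (n+1) p :=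
  f.comp <|
    (TensorProduct.map (LinearMap.id : (Pk k A n : Type) →ₗ[k] _) ωM).comp
      (TensorProduct.assoc k (Pk k A n : Type) A M).toLinearMap

/-- `b_{n+1}` in the Yetter-Drinfel'd case. -/
def faceLastYD (n p : ℕ) (f : Yc k A M N n p) : Yc k A M N (n+1) p :=
  (rdiagE k A p).comp <|
    ((TensorProduct.comm k A (Cd k A N p)).toLinearMap).comp <|
      (TensorProduct.map (LinearMap.id : A →ₗ[k] A)
        (f.comp (TensorProduct.map (LinearMap.id : (Pk k A n : Type) →ₗ[k] _) ωM))).comp <|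
        ((TensorProduct.leftComm k (Pk k A n : Type) A (A ⊗[k] M)).toLinearMap).comp <|
          (TensorProduct.map (LinearMap.id : (Pk k A n : Type) →ₗ[k] _)
            (TensorProduct.assoc k A A M).toLinearMap).comp <|
            ((TensorProduct.assoc k (Pk k A n : Type) (A ⊗[k] A) M).toLinearMap).comp
              (TensorProduct.map
                (TensorProduct.map (LinearMap.id : (Pk k A n : Type) →ₗ[k] _) (ΔA k A))
                (LinearMap.id : M →ₗ[k] M))

/-- The Yetter-Drinfel'd horizontal faces `b_i^{n,p}`, `0 ≤ i ≤ n+1`. -/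
def bYD (n p : ℕ) (i : ℕ) (f : Yc k A M N n p) : Yc k A M N (n+1) p :=
  if i = 0 then face0 k A ωN n p f
  else if i ≤ n then faceMid k A n p i f
  else faceLastYD k A ωM n p f

/-- The Hopf-module horizontal faces `b_i^{n,p}`, `0 ≤ i ≤ n+1`. -/
def bH (n p : ℕ) (i : ℕ) (f : Yc k A M N n p) : Yc k A M N (n+1) p :=
  if i = 0 then face0 k A ωN n p f
  else if i ≤ n then faceMid k A n p i f
  else faceLastH k A ωM n p f

/-- `c_0` in the Hopf-module case: apply `ρ_N` to the `N`-component of the output. -/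
def cof0H (n p : ℕ) (f : Yc k A M N n p) : Yc k A M N n (p+1) :=
  ((shiftB k A p).toLinearMap).comp ((rhoBase k A ρN p).comp f)

/-- `c_0` in the Yetter-Drinfel'd case. -/
def cof0YD (n p : ℕ) (f : Yc k A M N n p) : Yc k A M N n (p+1) :=
  ((shiftB k A p).toLinearMap).comp <|
    (rmulBase k A p).comp <|
      ((TensorProduct.comm k A
          (pwr k A (ModuleCat.of k (N ⊗[k] A)) p : Type)).toLinearMap).comp <|
        (TensorProduct.map (LinearMap.id : A →ₗ[k] A) ((rhoBase k A ρN p).comp f)).comp <|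
          ((TensorProduct.assoc k A (Pk k A n : Type) M).toLinearMap).comp
            (TensorProduct.map (dL k A n) (LinearMap.id : M →ₗ[k] M))

/-- `c_{p+1}`: uses the right comodule structure of `M`. -/
def cofLast (n p : ℕ) (f : Yc k A M N n p) : Yc k A M N n (p+1) :=
  (TensorProduct.map f (μA k A)).comp <|
    ((TensorProduct.tensorTensorTensorComm k (Pk k A n : Type) A M A).toLinearMap).comp
      (TensorProduct.map (dR k A n) ρM)

/-- The Yetter-Drinfel'd vertical cofaces `c_j^{n,p}`, `0 ≤ j ≤ p+1`. -/
def cYD (n p : ℕ) (j : ℕ) (f : Yc k A M N n p) : Yc k A M N n (p+1) :=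
  if j = 0 then cof0YD k A ρN n p f
  else if j ≤ p then (comulAt k A p j).comp f
  else cofLast k A ρM n p f

/-- The Hopf-module vertical cofaces `c_j^{n,p}`, `0 ≤ j ≤ p+1`. -/
def cH (n p : ℕ) (j : ℕ) (f : Yc k A M N n p) : Yc k A M N n (p+1) :=
  if j = 0 then cof0H k A ρN n p f
  else if j ≤ p then (comulAt k A p j).comp f
  else cofLast k A ρM n p f

/-- The horizontal differential (Yetter-Drinfel'd case). -/
def dmYD (n p : ℕ) (f : Yc k A M N n p) : Yc k A M N (n+1) p :=
  ∑ i ∈ Finset.range (n+2), ((-1 : ℤ)^i) • bYD k A ωM ωN n p i f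

/-- The vertical differential (Yetter-Drinfel'd case). -/
def dcYD (n p : ℕ) (f : Yc k A M N n p) : Yc k A M N n (p+1) :=
  ∑ j ∈ Finset.range (p+2), ((-1 : ℤ)^j) • cYD k A ρM ρN n p j f

/-- The horizontal differential (Hopf-module case). -/
def dmH (n p : ℕ) (f : Yc k A M N n p) : Yc k A M N (n+1) p :=
  ∑ i ∈ Finset.range (n+2), ((-1 : ℤ)^i) • bH k A ωM ωN n p i f

/-- The vertical differential (Hopf-module case). -/
def dcH (n p : ℕ) (f : Yc k A M N n p) : Yc k A M N n (p+1) :=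
  ∑ j ∈ Finset.range (p+2), ((-1 : ℤ)^j) • cH k A ρM ρN n p j f

end Bicomplex

section Structures

variable {M : Type} [AddCommGroup M] [Module k M]

/-- `(M, ωM)` is a left `A`-module. -/
def IsModule (ωM : A ⊗[k] M →ₗ[k] M) : Prop :=
  (∀ m : M, ωM ((1 : A) ⊗ₜ m) = m) ∧
  ∀ (a b : A) (m : M), ωM (a ⊗ₜ ωM (b ⊗ₜ m)) = ωM ((a * b) ⊗ₜ m)

/-- `(M, ρM)` is a right `A`-comodule. -/
def IsComodule (ρM : M →ₗ[k] M ⊗[k] A) : Prop :=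
  ((TensorProduct.rid k M).toLinearMap.comp
      ((TensorProduct.map (LinearMap.id : M →ₗ[k] M) (εA k A)).comp ρM) = LinearMap.id) ∧
  (TensorProduct.map ρM (LinearMap.id : A →ₗ[k] A)).comp ρM =
    ((TensorProduct.assoc k M A A).symm.toLinearMap).comp
      ((TensorProduct.map (LinearMap.id : M →ₗ[k] M) (ΔA k A)).comp ρM)

/-- The map `a ⊗ m ↦ Σ a_1·m_0 ⊗ a_2 m_1`. -/
def hopfRHS (ωM : A ⊗[k] M →ₗ[k] M) (ρM : M →ₗ[k] M ⊗[k] A) :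
    A ⊗[k] M →ₗ[k] M ⊗[k] A :=
  (TensorProduct.map ωM (μA k A)).comp <|
    ((TensorProduct.tensorTensorTensorComm k A A M A).toLinearMap).comp
      (TensorProduct.map (ΔA k A) ρM)

/-- The map `a ⊗ m ↦ Σ (a_2·m)_0 ⊗ (a_2·m)_1 a_1`. -/
def ydLHS (ωM : A ⊗[k] M →ₗ[k] M) (ρM : M →ₗ[k] M ⊗[k] A) :
    A ⊗[k] M →ₗ[k] M ⊗[k] A :=
  (TensorProduct.map (LinearMap.id : M →ₗ[k] M) (μA k A)).comp <|
    ((TensorProduct.assoc k M A A).toLinearMap).comp <|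
      ((TensorProduct.comm k A (M ⊗[k] A)).toLinearMap).comp <|
        (TensorProduct.map (LinearMap.id : A →ₗ[k] A) (ρM.comp ωM)).comp <|
          ((TensorProduct.assoc k A A M).toLinearMap).comp
            (TensorProduct.map (ΔA k A) (LinearMap.id : M →ₗ[k] M))

/-- `(M, ωM, ρM)` is a left-right Yetter-Drinfel'd module over `A`. -/
def IsYetterDrinfeld (ωM : A ⊗[k] M →ₗ[k] M) (ρM : M →ₗ[k] M ⊗[k] A) : Prop :=
  IsModule k A ωM ∧ IsComodule k A ρM ∧
    ydLHS k A ωM ρM = hopfRHS k A ωM ρM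

/-- `(M, ωM, ρM)` is a left-right Hopf module over `A`. -/
def IsHopfModule (ωM : A ⊗[k] M →ₗ[k] M) (ρM : M →ₗ[k] M ⊗[k] A) : Prop :=
  IsModule k A ωM ∧ IsComodule k A ρM ∧
    ρM.comp ωM = hopfRHS k A ωM ρM

end Structures

section TensorCoaction

variable {P Q : Type} [AddCommGroup P] [Module k P] [AddCommGroup Q] [Module k Q]

/-- The codiagonal right coaction on `P ⊗ Q`. -/
def tensorR (α : P →ₗ[k] P ⊗[k] A) (β : Q →ₗ[k] Q ⊗[k] A) :
    P ⊗[k] Q →ₗ[k] (P ⊗[k] Q) ⊗[k] A :=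
  (TensorProduct.map (LinearMap.id : (P ⊗[k] Q) →ₗ[k] _) (μA k A)).comp <|
    ((TensorProduct.tensorTensorTensorComm k P A Q A).toLinearMap).comp
      (TensorProduct.map α β)

/-- The codiagonal left coaction on `P ⊗ Q`. -/
def tensorL (α : P →ₗ[k] A ⊗[k] P) (β : Q →ₗ[k] A ⊗[k] Q) :
    P ⊗[k] Q →ₗ[k] A ⊗[k] (P ⊗[k] Q) :=
  (TensorProduct.map (μA k A) (LinearMap.id : (P ⊗[k] Q) →ₗ[k] _)).comp <|
    ((TensorProduct.tensorTensorTensorComm k A P A Q).toLinearMap).comp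
      (TensorProduct.map α β)

/-- Coassociativity of a right coaction. -/
def CoassocR (α : P →ₗ[k] P ⊗[k] A) : Prop :=
  ∀ x, α.rTensor A (α x) = (TensorProduct.assoc k P A A).symm ((ΔA k A).lTensor P (α x))

/-- Coassociativity of a left coaction. -/
def CoassocL (α : P →ₗ[k] A ⊗[k] P) : Prop :=
  ∀ x, α.lTensor A (α x) = TensorProduct.assoc k A A P ((ΔA k A).rTensor P (α x))

/-- Compatibility of a left and a right coaction. -/
def Cocommute (l : P →ₗ[k] A ⊗[k] P) (r : P →ₗ[k] P ⊗[k] A) : Prop :=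
  ∀ x, l.rTensor A (r x) = (TensorProduct.assoc k A P A).symm (r.lTensor A (l x))

/-- `(p ⊗ a ⊗ c) ⊗ (q ⊗ b ⊗ d) ↦ (p ⊗ q) ⊗ ab ⊗ cd`. -/
def mulR : ((P ⊗[k] A) ⊗[k] A) ⊗[k] ((Q ⊗[k] A) ⊗[k] A) →ₗ[k] ((P ⊗[k] Q) ⊗[k] A) ⊗[k] A :=
  (TensorProduct.map ((TensorProduct.map LinearMap.id (μA k A)).comp
    (TensorProduct.tensorTensorTensorComm k P A Q A).toLinearMap) (μA k A)).comp
    (TensorProduct.tensorTensorTensorComm k (P ⊗[k] A) A (Q ⊗[k] A) A).toLinearMap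

/-- `(a ⊗ c ⊗ p) ⊗ (b ⊗ d ⊗ q) ↦ ab ⊗ cd ⊗ (p ⊗ q)`. -/
def mulL : (A ⊗[k] (A ⊗[k] P)) ⊗[k] (A ⊗[k] (A ⊗[k] Q)) →ₗ[k] A ⊗[k] (A ⊗[k] (P ⊗[k] Q)) :=
  (TensorProduct.map (μA k A) ((TensorProduct.map (μA k A) LinearMap.id).comp
    (TensorProduct.tensorTensorTensorComm k A P A Q).toLinearMap)).comp
    (TensorProduct.tensorTensorTensorComm k A (A ⊗[k] P) A (A ⊗[k] Q)).toLinearMap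

/-- `(a ⊗ p ⊗ c) ⊗ (b ⊗ q ⊗ d) ↦ ab ⊗ (p ⊗ q) ⊗ cd`. -/
def mulLR : ((A ⊗[k] P) ⊗[k] A) ⊗[k] ((A ⊗[k] Q) ⊗[k] A) →ₗ[k] (A ⊗[k] (P ⊗[k] Q)) ⊗[k] A :=
  (TensorProduct.map ((TensorProduct.map (μA k A) LinearMap.id).comp
    (TensorProduct.tensorTensorTensorComm k A P A Q).toLinearMap) (μA k A)).comp
    (TensorProduct.tensorTensorTensorComm k (A ⊗[k] P) A (A ⊗[k] Q) A).toLinearMap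

variable {k A}
variable {αR : P →ₗ[k] P ⊗[k] A} {βR : Q →ₗ[k] Q ⊗[k] A}
variable {αL : P →ₗ[k] A ⊗[k] P} {βL : Q →ₗ[k] A ⊗[k] Q}

theorem CoassocR.tensor (hα : CoassocR k A αR) (hβ : CoassocR k A βR) :
    CoassocR k A (tensorR k A αR βR) := by
  have h₁ : ((tensorR k A αR βR).rTensor A).comp ((TensorProduct.map LinearMap.id (μA k A)).comp
      (TensorProduct.tensorTensorTensorComm k P A Q A).toLinearMap) =
      (mulR k A).comp (TensorProduct.map (αR.rTensor A) (βR.rTensor A)) := by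
    ext p a q b
    simp [tensorR, mulR]
  have h₂ : ((TensorProduct.assoc k (P ⊗[k] Q) A A).symm.toLinearMap.comp
      ((ΔA k A).lTensor (P ⊗[k] Q))).comp ((TensorProduct.map LinearMap.id (μA k A)).comp
      (TensorProduct.tensorTensorTensorComm k P A Q A).toLinearMap) =
      (mulR k A).comp (TensorProduct.map
        ((TensorProduct.assoc k P A A).symm.toLinearMap.comp ((ΔA k A).lTensor P))
        ((TensorProduct.assoc k Q A A).symm.toLinearMap.comp ((ΔA k A).lTensor Q))) := by
    ext p a q b
    simp only [mulR, TensorProduct.AlgebraTensorModule.curry_apply, LinearMap.restrictScalars_self,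
      TensorProduct.curry_apply, LinearMap.comp_apply, LinearEquiv.coe_coe,
      TensorProduct.tensorTensorTensorComm_tmul, TensorProduct.map_tmul, LinearMap.lTensor_tmul,
      LinearMap.id_apply, LinearMap.mul'_apply, Bialgebra.comul_mul]
    generalize (Coalgebra.comul (R := k) a) = u
    generalize (Coalgebra.comul (R := k) b) = v
    induction u with
    | zero => simp
    | add u₁ u₂ h₁ h₂ =>
      simp only [add_mul, TensorProduct.tmul_add, TensorProduct.add_tmul, map_add, h₁, h₂]
    | tmul a a' =>
      induction v with
      | zero => simp
      | add u₁ u₂ h₁ h₂ => simp only [mul_add, TensorProduct.tmul_add, map_add, h₁, h₂]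
      | tmul b b' => simp
  intro x
  induction x with
  | zero => simp
  | add x y hx hy => simp only [map_add, hx, hy]
  | tmul p q =>
    have e₁ := LinearMap.congr_fun h₁ (αR p ⊗ₜ βR q)
    have e₂ := LinearMap.congr_fun h₂ (αR p ⊗ₜ βR q)
    simp only [LinearMap.comp_apply, LinearEquiv.coe_coe, TensorProduct.map_tmul] at e₁ e₂
    simp only [tensorR, LinearMap.comp_apply, LinearEquiv.coe_coe, TensorProduct.map_tmul]
    rw [e₂, ← hα, ← hβ, ← e₁]
    rfl

theorem CoassocL.tensor (hα : CoassocL k A αL) (hβ : CoassocL k A βL) :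
    CoassocL k A (tensorL k A αL βL) := by
  have h₁ : ((tensorL k A αL βL).lTensor A).comp ((TensorProduct.map (μA k A) LinearMap.id).comp
      (TensorProduct.tensorTensorTensorComm k A P A Q).toLinearMap) =
      (mulL k A).comp (TensorProduct.map (αL.lTensor A) (βL.lTensor A)) := by
    ext a p b q
    simp [tensorL, mulL]
  have h₂ : ((TensorProduct.assoc k A A (P ⊗[k] Q)).toLinearMap.comp
      ((ΔA k A).rTensor (P ⊗[k] Q))).comp ((TensorProduct.map (μA k A) LinearMap.id).comp
      (TensorProduct.tensorTensorTensorComm k A P A Q).toLinearMap) =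
      (mulL k A).comp (TensorProduct.map
        ((TensorProduct.assoc k A A P).toLinearMap.comp ((ΔA k A).rTensor P))
        ((TensorProduct.assoc k A A Q).toLinearMap.comp ((ΔA k A).rTensor Q))) := by
    ext a p b q
    simp only [mulL, TensorProduct.AlgebraTensorModule.curry_apply, LinearMap.restrictScalars_self,
      TensorProduct.curry_apply, LinearMap.comp_apply, LinearEquiv.coe_coe,
      TensorProduct.tensorTensorTensorComm_tmul, TensorProduct.map_tmul, LinearMap.rTensor_tmul,
      LinearMap.id_apply, LinearMap.mul'_apply, Bialgebra.comul_mul]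
    generalize (Coalgebra.comul (R := k) a) = u
    generalize (Coalgebra.comul (R := k) b) = v
    induction u with
    | zero => simp
    | add u₁ u₂ h₁ h₂ => simp only [add_mul, TensorProduct.add_tmul, map_add, h₁, h₂]
    | tmul a a' =>
      induction v with
      | zero => simp
      | add u₁ u₂ h₁ h₂ =>
        simp only [mul_add, TensorProduct.tmul_add, TensorProduct.add_tmul, map_add, h₁, h₂]
      | tmul b b' => simp
  intro x
  induction x with
  | zero => simp
  | add x y hx hy => simp only [map_add, hx, hy]
  | tmul p q =>
    have e₁ := LinearMap.congr_fun h₁ (αL p ⊗ₜ βL q)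
    have e₂ := LinearMap.congr_fun h₂ (αL p ⊗ₜ βL q)
    simp only [LinearMap.comp_apply, LinearEquiv.coe_coe, TensorProduct.map_tmul] at e₁ e₂
    simp only [tensorL, LinearMap.comp_apply, LinearEquiv.coe_coe, TensorProduct.map_tmul]
    rw [e₂, ← hα, ← hβ, ← e₁]
    rfl

theorem Cocommute.tensor (hα : Cocommute k A αL αR) (hβ : Cocommute k A βL βR) :
    Cocommute k A (tensorL k A αL βL) (tensorR k A αR βR) := by
  have h₁ : ((tensorL k A αL βL).rTensor A).comp ((TensorProduct.map LinearMap.id (μA k A)).comp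
      (TensorProduct.tensorTensorTensorComm k P A Q A).toLinearMap) =
      (mulLR k A).comp (TensorProduct.map (αL.rTensor A) (βL.rTensor A)) := by
    ext p a q b
    simp [tensorL, mulLR]
  have h₂ : ((TensorProduct.assoc k A (P ⊗[k] Q) A).symm.toLinearMap.comp
      ((tensorR k A αR βR).lTensor A)).comp ((TensorProduct.map (μA k A) LinearMap.id).comp
      (TensorProduct.tensorTensorTensorComm k A P A Q).toLinearMap) =
      (mulLR k A).comp (TensorProduct.map
        ((TensorProduct.assoc k A P A).symm.toLinearMap.comp (αR.lTensor A))
        ((TensorProduct.assoc k A Q A).symm.toLinearMap.comp (βR.lTensor A))) := by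
    ext a p b q
    simp only [mulLR, tensorR, TensorProduct.AlgebraTensorModule.curry_apply,
      LinearMap.restrictScalars_self,
      TensorProduct.curry_apply, LinearMap.comp_apply, LinearEquiv.coe_coe,
      TensorProduct.tensorTensorTensorComm_tmul, TensorProduct.map_tmul, LinearMap.lTensor_tmul,
      LinearMap.id_apply, LinearMap.mul'_apply]
    generalize αR p = u
    generalize βR q = v
    induction u with
    | zero => simp
    | add u₁ u₂ h₁ h₂ => simp only [TensorProduct.tmul_add, TensorProduct.add_tmul, map_add, h₁, h₂]
    | tmul a a' =>
      induction v with
      | zero => simp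
      | add u₁ u₂ h₁ h₂ => simp only [TensorProduct.tmul_add, map_add, h₁, h₂]
      | tmul b b' => simp
  intro x
  induction x with
  | zero => simp
  | add x y hx hy => simp only [map_add, hx, hy]
  | tmul p q =>
    have e₁ := LinearMap.congr_fun h₁ (αR p ⊗ₜ βR q)
    have e₂ := LinearMap.congr_fun h₂ (αL p ⊗ₜ βL q)
    simp only [LinearMap.comp_apply, LinearEquiv.coe_coe, TensorProduct.map_tmul] at e₁ e₂
    rw [← hα, ← hβ, ← e₁] at e₂
    exact e₂.symm

/-- The left coaction of `P` makes `P ⊗ Q` a left comodule. -/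
theorem CoassocL.assoc_rTensor (hα : CoassocL k A αL) :
    CoassocL k A ((TensorProduct.assoc k A P Q).toLinearMap.comp (αL.rTensor Q)) := by
  intro x
  induction x with
  | zero => simp
  | add x y hx hy => simp only [map_add, hx, hy]
  | tmul p q =>
    have h₁ : ∀ u : A ⊗[k] P,
        ((TensorProduct.assoc k A P Q).toLinearMap.comp (αL.rTensor Q)).lTensor A
          (TensorProduct.assoc k A P Q (u ⊗ₜ q)) =
        (TensorProduct.assoc k A P Q).toLinearMap.lTensor A
          (TensorProduct.assoc k A (A ⊗[k] P) Q (αL.lTensor A u ⊗ₜ q)) := by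
      intro u
      induction u with
      | zero => simp
      | add x y hx hy => simp only [map_add, TensorProduct.add_tmul, hx, hy]
      | tmul a p => simp
    have h₂ : ∀ u : A ⊗[k] P,
        TensorProduct.assoc k A A (P ⊗[k] Q) ((ΔA k A).rTensor (P ⊗[k] Q)
          (TensorProduct.assoc k A P Q (u ⊗ₜ q))) =
        (TensorProduct.assoc k A P Q).toLinearMap.lTensor A
          (TensorProduct.assoc k A (A ⊗[k] P) Q
            (TensorProduct.assoc k A A P ((ΔA k A).rTensor P u) ⊗ₜ q)) := by
      intro u
      induction u with
      | zero => simp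
      | add x y hx hy => simp only [map_add, TensorProduct.add_tmul, hx, hy]
      | tmul a p =>
        simp only [TensorProduct.assoc_tmul, LinearMap.rTensor_tmul]
        generalize ΔA k A a = v
        induction v with
        | zero => simp
        | add x y hx hy => simp only [map_add, TensorProduct.add_tmul, hx, hy]
        | tmul b c => simp
    simp only [LinearMap.comp_apply, LinearEquiv.coe_coe, LinearMap.rTensor_tmul]
    rw [h₁, h₂, hα]

theorem Cocommute.assoc_rTensor (hα : Cocommute k A αL αR) :
    Cocommute k A ((TensorProduct.assoc k A P Q).toLinearMap.comp (αL.rTensor Q))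
      (tensorR k A αR βR) := by
  intro x
  induction x with
  | zero => simp
  | add x y hx hy => simp only [map_add, hx, hy]
  | tmul p q =>
    let Ψ : ((A ⊗[k] P) ⊗[k] A) ⊗[k] (Q ⊗[k] A) →ₗ[k] (A ⊗[k] (P ⊗[k] Q)) ⊗[k] A :=
      (TensorProduct.map (TensorProduct.assoc k A P Q).toLinearMap (μA k A)).comp
        (TensorProduct.tensorTensorTensorComm k (A ⊗[k] P) A Q A).toLinearMap
    have h₁ : ((TensorProduct.assoc k A P Q).toLinearMap.comp (αL.rTensor Q)).rTensor A
        (tensorR k A αR βR (p ⊗ₜ q)) = Ψ (αL.rTensor A (αR p) ⊗ₜ βR q) := by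
      simp only [tensorR, LinearMap.comp_apply, TensorProduct.map_tmul, LinearEquiv.coe_coe]
      generalize αR p = u
      generalize βR q = v
      induction u with
      | zero => simp
      | add u₁ u₂ h₁ h₂ => simp only [TensorProduct.add_tmul, map_add, h₁, h₂]
      | tmul a a' =>
        induction v with
        | zero => simp
        | add u₁ u₂ h₁ h₂ => simp only [TensorProduct.tmul_add, map_add, h₁, h₂]
        | tmul b b' => simp [Ψ]
    have h₂ : ∀ u : A ⊗[k] P, (TensorProduct.assoc k A (P ⊗[k] Q) A).symm
        ((tensorR k A αR βR).lTensor A (TensorProduct.assoc k A P Q (u ⊗ₜ q))) =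
        Ψ ((TensorProduct.assoc k A P A).symm (αR.lTensor A u) ⊗ₜ βR q) := by
      intro u
      induction u with
      | zero => simp
      | add u₁ u₂ h₁ h₂ => simp only [TensorProduct.add_tmul, map_add, h₁, h₂]
      | tmul a p =>
        simp only [tensorR, LinearMap.comp_apply, TensorProduct.map_tmul, LinearEquiv.coe_coe,
          TensorProduct.assoc_tmul, LinearMap.lTensor_tmul]
        generalize αR p = u
        generalize βR q = v
        induction u with
        | zero => simp
        | add u₁ u₂ h₁ h₂ =>
          simp only [TensorProduct.tmul_add, TensorProduct.add_tmul, map_add, h₁, h₂]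
        | tmul a a' =>
          induction v with
          | zero => simp
          | add u₁ u₂ h₁ h₂ => simp only [TensorProduct.tmul_add, map_add, h₁, h₂]
          | tmul b b' => simp [Ψ]
    rw [h₁, hα, ← h₂]
    rfl

/-- Comultiplication of the last tensorand makes `P ⊗ A` a right comodule. -/
theorem coassocR_comul_last : CoassocR k A
    ((TensorProduct.assoc k P A A).symm.toLinearMap.comp ((ΔA k A).lTensor P)) := by
  intro x
  induction x with
  | zero => simp
  | add x y hx hy => simp only [map_add, hx, hy]
  | tmul p a =>
    have h₁ : ∀ u : A ⊗[k] A,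
        ((TensorProduct.assoc k P A A).symm.toLinearMap.comp ((ΔA k A).lTensor P)).rTensor A
          ((TensorProduct.assoc k P A A).symm (p ⊗ₜ u)) =
        (TensorProduct.assoc k P A A).symm.toLinearMap.rTensor A
          ((TensorProduct.assoc k P (A ⊗[k] A) A).symm (p ⊗ₜ (ΔA k A).rTensor A u)) := by
      intro u
      induction u with
      | zero => simp
      | add x y hx hy => simp only [map_add, TensorProduct.tmul_add, hx, hy]
      | tmul a b => simp
    have h₂ : ∀ u : A ⊗[k] A,
        (TensorProduct.assoc k (P ⊗[k] A) A A).symm ((ΔA k A).lTensor (P ⊗[k] A)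
          ((TensorProduct.assoc k P A A).symm (p ⊗ₜ u))) =
        (TensorProduct.assoc k P A A).symm.toLinearMap.rTensor A
          ((TensorProduct.assoc k P (A ⊗[k] A) A).symm
            (p ⊗ₜ (TensorProduct.assoc k A A A).symm ((ΔA k A).lTensor A u))) := by
      intro u
      induction u with
      | zero => simp
      | add x y hx hy => simp only [map_add, TensorProduct.tmul_add, hx, hy]
      | tmul a b =>
        simp only [TensorProduct.assoc_symm_tmul, LinearMap.lTensor_tmul]
        generalize ΔA k A b = v
        induction v with
        | zero => simp
        | add x y hx hy => simp only [map_add, TensorProduct.tmul_add, hx, hy]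
        | tmul b c => simp
    simp only [LinearMap.comp_apply, LinearEquiv.coe_coe, LinearMap.lTensor_tmul]
    rw [h₁, h₂, Coalgebra.coassoc_symm_apply]

/-- Naturality of the comultiplication of the last tensorand. -/
theorem comul_last_rTensor (g : P →ₗ[k] Q) (x : P ⊗[k] A) :
    (TensorProduct.assoc k Q A A).symm ((ΔA k A).lTensor Q (g.rTensor A x)) =
      (g.rTensor A).rTensor A ((TensorProduct.assoc k P A A).symm ((ΔA k A).lTensor P x)) := by
  induction x with
  | zero => simp
  | add x y hx hy => simp only [map_add, hx, hy]
  | tmul p a =>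
    simp only [LinearMap.rTensor_tmul, LinearMap.lTensor_tmul]
    generalize ΔA k A a = v
    induction v with
    | zero => simp
    | add x y hx hy => simp only [map_add, TensorProduct.tmul_add, hx, hy]
    | tmul b c => simp

variable {R S : Type} [AddCommGroup R] [Module k R] [AddCommGroup S] [Module k S]

theorem rTensor_rTensor_congr {f : Q →ₗ[k] S} {g : P →ₗ[k] Q} {f' : R →ₗ[k] S} {g' : P →ₗ[k] R}
    (h : ∀ x, f (g x) = f' (g' x)) (x : P ⊗[k] A) :
    f.rTensor A (g.rTensor A x) = f'.rTensor A (g'.rTensor A x) := by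
  rw [← LinearMap.rTensor_comp_apply, ← LinearMap.rTensor_comp_apply]
  congr 2
  exact LinearMap.ext h

theorem assoc_comul_lTensor (g : P →ₗ[k] Q) (x : A ⊗[k] P) :
    TensorProduct.assoc k A A Q ((ΔA k A).rTensor Q (g.lTensor A x)) =
      (g.lTensor A).lTensor A (TensorProduct.assoc k A A P ((ΔA k A).rTensor P x)) := by
  induction x with
  | zero => simp
  | add x y hx hy => simp only [map_add, hx, hy]
  | tmul a p =>
    simp only [LinearMap.rTensor_tmul, LinearMap.lTensor_tmul]
    generalize ΔA k A a = v
    induction v with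
    | zero => simp
    | add x y hx hy => simp only [map_add, TensorProduct.add_tmul, hx, hy]
    | tmul b c => simp

theorem assoc_symm_lTensor_rTensor (g : P →ₗ[k] Q) (x : A ⊗[k] (P ⊗[k] A)) :
    (TensorProduct.assoc k A Q A).symm ((g.rTensor A).lTensor A x) =
      (g.lTensor A).rTensor A ((TensorProduct.assoc k A P A).symm x) := by
  have : (TensorProduct.assoc k A Q A).symm.toLinearMap.comp ((g.rTensor A).lTensor A) =
      ((g.lTensor A).rTensor A).comp (TensorProduct.assoc k A P A).symm.toLinearMap := by
    ext a p b
    simp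
  exact LinearMap.congr_fun this x

/-- Naturality of the last comultiplication with respect to reassociation. -/
theorem comul_last_assoc_symm (x : A ⊗[k] (P ⊗[k] A)) :
    (TensorProduct.assoc k (A ⊗[k] P) A A).symm ((ΔA k A).lTensor (A ⊗[k] P)
      ((TensorProduct.assoc k A P A).symm x)) =
    (TensorProduct.assoc k A P A).symm.toLinearMap.rTensor A
      ((TensorProduct.assoc k A (P ⊗[k] A) A).symm
        (((TensorProduct.assoc k P A A).symm.toLinearMap.comp
          ((ΔA k A).lTensor P)).lTensor A x)) := by
  have : (TensorProduct.assoc k (A ⊗[k] P) A A).symm.toLinearMap.comp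
      (((ΔA k A).lTensor (A ⊗[k] P)).comp (TensorProduct.assoc k A P A).symm.toLinearMap) =
      ((TensorProduct.assoc k A P A).symm.toLinearMap.rTensor A).comp
      ((TensorProduct.assoc k A (P ⊗[k] A) A).symm.toLinearMap.comp
        (((TensorProduct.assoc k P A A).symm.toLinearMap.comp
          ((ΔA k A).lTensor P)).lTensor A)) := by
    ext a p b
    simp only [TensorProduct.AlgebraTensorModule.curry_apply, LinearMap.restrictScalars_self,
      TensorProduct.curry_apply, LinearMap.comp_apply, LinearEquiv.coe_coe,
      TensorProduct.assoc_symm_tmul, LinearMap.lTensor_tmul]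
    generalize ΔA k A b = v
    induction v with
    | zero => simp
    | add x y hx hy => simp only [map_add, TensorProduct.tmul_add, hx, hy]
    | tmul b c => simp
  exact LinearMap.congr_fun this x

theorem eq_rTensor_assoc_symm {E : A ⊗[k] P →ₗ[k] Q} {F : A ⊗[k] (P ⊗[k] A) →ₗ[k] Q ⊗[k] A}
    (h : ∀ a x b, F (a ⊗ₜ (x ⊗ₜ b)) = E (a ⊗ₜ x) ⊗ₜ b) :
    F = (E.rTensor A).comp (TensorProduct.assoc k A P A).symm.toLinearMap := by
  ext a x b
  simp [h]

theorem rTensor_comul_assoc_symm {E : A ⊗[k] P →ₗ[k] Q} {F : A ⊗[k] (P ⊗[k] A) →ₗ[k] Q ⊗[k] A}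
    {E' : A ⊗[k] Q →ₗ[k] R} {F' : A ⊗[k] (Q ⊗[k] A) →ₗ[k] R ⊗[k] A}
    (h : ∀ a x b, F (a ⊗ₜ (x ⊗ₜ b)) = E (a ⊗ₜ x) ⊗ₜ b)
    (h' : ∀ a x b, F' (a ⊗ₜ (x ⊗ₜ b)) = E' (a ⊗ₜ x) ⊗ₜ b) (x : A ⊗[k] (P ⊗[k] A)) :
    E'.rTensor A (((E.lTensor A).comp ((TensorProduct.assoc k A A P).toLinearMap.comp
      ((ΔA k A).rTensor P))).rTensor A ((TensorProduct.assoc k A P A).symm x)) =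
    F' (F.lTensor A (TensorProduct.assoc k A A (P ⊗[k] A) ((ΔA k A).rTensor (P ⊗[k] A) x))) := by
  rw [← LinearMap.rTensor_comp_apply]
  induction x with
  | zero => simp
  | add x y hx hy => simp only [map_add, hx, hy]
  | tmul a y =>
    induction y with
    | zero => simp
    | add x y hx hy => simp only [TensorProduct.tmul_add, map_add, hx, hy]
    | tmul x b =>
      simp only [TensorProduct.assoc_symm_tmul, LinearMap.rTensor_tmul, LinearMap.comp_apply,
        LinearEquiv.coe_coe]
      generalize ΔA k A a = v
      induction v with
      | zero => simp
      | add x y hx hy => simp only [map_add, TensorProduct.add_tmul, hx, hy]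
      | tmul c d => simp [h, h']

/-- Comultiplicativity of `a ⊗ x ↦ Σ x_0 ⊗ x_1 a`. -/
theorem CoassocR.comul_mul {E : A ⊗[k] P →ₗ[k] P ⊗[k] A} (hα : CoassocR k A αR)
    (hE : ∀ a x, E (a ⊗ₜ x) = (μA k A).lTensor P (TensorProduct.assoc k P A A (αR x ⊗ₜ a)))
    (x : A ⊗[k] P) :
    (TensorProduct.assoc k P A A).symm ((ΔA k A).lTensor P (E x)) =
      E.rTensor A ((TensorProduct.assoc k A P A).symm (E.lTensor A
        (TensorProduct.assoc k A A P ((ΔA k A).rTensor P x)))) := by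
  induction x with
  | zero => simp
  | add x y hx hy => simp only [map_add, hx, hy]
  | tmul a x =>
    let Ψ : ((P ⊗[k] A) ⊗[k] A) ⊗[k] (A ⊗[k] A) →ₗ[k] (P ⊗[k] A) ⊗[k] A :=
      (TensorProduct.map (((μA k A).lTensor P).comp (TensorProduct.assoc k P A A).toLinearMap)
        (μA k A)).comp (TensorProduct.tensorTensorTensorComm k (P ⊗[k] A) A A A).toLinearMap
    have h₁ : ∀ u : P ⊗[k] A, (TensorProduct.assoc k P A A).symm ((ΔA k A).lTensor P
        ((μA k A).lTensor P (TensorProduct.assoc k P A A (u ⊗ₜ a)))) =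
        Ψ ((TensorProduct.assoc k P A A).symm ((ΔA k A).lTensor P u) ⊗ₜ ΔA k A a) := by
      intro u
      induction u with
      | zero => simp
      | add x y hx hy => simp only [map_add, TensorProduct.add_tmul, hx, hy]
      | tmul p c =>
        simp only [TensorProduct.assoc_tmul, LinearMap.lTensor_tmul, LinearMap.mul'_apply,
          Bialgebra.comul_mul]
        generalize (Coalgebra.comul (R := k) c) = u
        generalize (Coalgebra.comul (R := k) a) = v
        induction u with
        | zero => simp
        | add u₁ u₂ h₁ h₂ =>
          simp only [add_mul, TensorProduct.tmul_add, TensorProduct.add_tmul, map_add, h₁, h₂]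
        | tmul c c' =>
          induction v with
          | zero => simp
          | add u₁ u₂ h₁ h₂ => simp only [mul_add, TensorProduct.tmul_add, map_add, h₁, h₂]
          | tmul b b' => simp [Ψ]
    have h₂ : ∀ v : A ⊗[k] A, E.rTensor A ((TensorProduct.assoc k A P A).symm (E.lTensor A
        (TensorProduct.assoc k A A P (v ⊗ₜ x)))) = Ψ (αR.rTensor A (αR x) ⊗ₜ v) := by
      intro v
      induction v with
      | zero => simp
      | add x y hx hy => simp only [map_add, TensorProduct.tmul_add, TensorProduct.add_tmul, hx, hy]
      | tmul b b' =>
        simp only [TensorProduct.assoc_tmul, LinearMap.lTensor_tmul, hE]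
        generalize αR x = u
        induction u with
        | zero => simp
        | add x y hx hy =>
          simp only [map_add, TensorProduct.tmul_add, TensorProduct.add_tmul, hx, hy]
        | tmul p c => simp [Ψ, hE]
    rw [hE, h₁, LinearMap.rTensor_tmul, h₂, hα]

variable (k A)

theorem coassocR_unit : CoassocR k A
    ((TensorProduct.map (LinearMap.id : k →ₗ[k] k) (Algebra.linearMap k A)).comp
      (TensorProduct.rid k k).symm.toLinearMap) := by
  intro x
  simp [Algebra.TensorProduct.one_def]

theorem coassocL_unit : CoassocL k A
    ((TensorProduct.map (Algebra.linearMap k A) (LinearMap.id : k →ₗ[k] k)).comp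
      (TensorProduct.lid k k).symm.toLinearMap) := by
  intro x
  simp [Algebra.TensorProduct.one_def]

theorem cocommute_unit : Cocommute k A
    ((TensorProduct.map (Algebra.linearMap k A) (LinearMap.id : k →ₗ[k] k)).comp
      (TensorProduct.lid k k).symm.toLinearMap)
    ((TensorProduct.map (LinearMap.id : k →ₗ[k] k) (Algebra.linearMap k A)).comp
      (TensorProduct.rid k k).symm.toLinearMap) := by
  intro x
  simp

end TensorCoaction

theorem coassocR_dR : ∀ n, CoassocR k A (dR k A n)
  | 0 => coassocR_unit k A
  | n + 1 => (coassocR_dR n).tensor fun x => (Coalgebra.coassoc_symm_apply x).symm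

theorem coassocL_dL : ∀ n, CoassocL k A (dL k A n)
  | 0 => coassocL_unit k A
  | n + 1 => (coassocL_dL n).tensor fun x => (Coalgebra.coassoc_apply x).symm

theorem cocommute_dL_dR : ∀ n, Cocommute k A (dL k A n) (dR k A n)
  | 0 => cocommute_unit k A
  | n + 1 => (cocommute_dL_dR n).tensor fun x => (Coalgebra.coassoc_symm_apply x).symm

section Cofaces

variable {N : Type} [AddCommGroup N] [Module k N]

theorem comulAt_last (p : ℕ) :
    (comulAt k A (N := N) (p + 1) (p + 1) : Cd k A N p ⊗[k] A →ₗ[k] (Cd k A N p ⊗[k] A) ⊗[k] A) =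
      (TensorProduct.assoc k (Cd k A N p) A A).symm.toLinearMap.comp
        ((ΔA k A).lTensor (Cd k A N p)) :=
  if_pos rfl

theorem comulAt_succ {p i : ℕ} (h : i ≠ p + 1) :
    (comulAt k A (N := N) (p + 1) i : Cd k A N p ⊗[k] A →ₗ[k] Cd k A N (p + 1) ⊗[k] A) =
      (comulAt k A (N := N) p i).rTensor A :=
  if_neg h

theorem comulAt_last_apply (p : ℕ) (x : Cd k A N p ⊗[k] A) :
    comulAt k A (N := N) (p + 1) (p + 1) x =
      (TensorProduct.assoc k (Cd k A N p) A A).symm ((ΔA k A).lTensor (Cd k A N p) x) :=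
  LinearMap.congr_fun (comulAt_last k A p) x

theorem comulAt_succ_apply {p i : ℕ} (h : i ≠ p + 1) (x : Cd k A N p ⊗[k] A) :
    comulAt k A (N := N) (p + 1) i x = (comulAt k A (N := N) p i).rTensor A x :=
  LinearMap.congr_fun (comulAt_succ k A h) x

theorem comulAt_comulAt {i j : ℕ} (hi : 1 ≤ i) (hij : i < j) : ∀ {p : ℕ}, j ≤ p + 1 →
    ∀ x : Cd k A N p, comulAt k A (p + 1) j (comulAt k A p i x) =
      comulAt k A (p + 1) i (comulAt k A p (j - 1) x)
  | 0, hj, _ => by omega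
  | p + 1, hj, x => by
    rcases Nat.lt_or_ge j (p + 2) with hj' | hj'
    · exact Eq.trans ((comulAt_succ_apply k A (by omega) _).trans
          (congrArg ((comulAt k A (p + 1) j).rTensor A) (comulAt_succ_apply k A (by omega) x))) <|
        Eq.trans (rTensor_rTensor_congr (comulAt_comulAt hi hij (by omega)) x) <|
        ((comulAt_succ_apply k A (by omega) _).trans
          (congrArg ((comulAt k A (p + 1) i).rTensor A)
            (comulAt_succ_apply k A (by omega) x))).symm
    · obtain rfl : j = p + 2 := by omega
      rcases Nat.lt_or_ge i (p + 1) with hi' | hi'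
      · exact Eq.trans ((comulAt_last_apply k A (p + 1) _).trans (congrArg
            (fun y => (TensorProduct.assoc k (Cd k A N (p + 1)) A A).symm
              ((ΔA k A).lTensor _ y)) (comulAt_succ_apply k A (by omega) x))) <|
          Eq.trans (comul_last_rTensor _ x) <|
          Eq.trans (congr (congrArg (fun f : Cd k A N p ⊗[k] A →ₗ[k] Cd k A N (p + 1) ⊗[k] A =>
            ⇑(f.rTensor A)) (comulAt_succ k A (by omega)).symm) (comulAt_last_apply k A p x).symm) <|
          (comulAt_succ_apply k A (by omega) _).symm
      · obtain rfl : i = p + 1 := by omega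
        exact Eq.trans ((comulAt_last_apply k A (p + 1) _).trans (congrArg
            (fun y => (TensorProduct.assoc k (Cd k A N p ⊗[k] A) A A).symm
              ((ΔA k A).lTensor _ y)) (comulAt_last_apply k A p x))) <|
          Eq.trans ((coassocR_comul_last x).symm) <|
          Eq.trans (congr (congrArg (fun f : Cd k A N p ⊗[k] A →ₗ[k] (Cd k A N p ⊗[k] A) ⊗[k] A =>
            ⇑(f.rTensor A)) (comulAt_last k A p).symm) (comulAt_last_apply k A p x).symm) <|
          (comulAt_succ_apply k A (by omega) _).symm

variable (ρN : N →ₗ[k] N ⊗[k] A)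

/-- `a ⊗ (y ⊗ b^1 ⊗ ⋯ ⊗ b^p) ↦ Σ y_0 ⊗ y_1 a ⊗ b^1 ⊗ ⋯ ⊗ b^p`. -/
def coactMul (p : ℕ) : A ⊗[k] Cd k A N p →ₗ[k] Cd k A N (p + 1) :=
  (shiftB k A p).toLinearMap.comp <| (rmulBase k A p).comp <|
    ((TensorProduct.comm k A
      (pwr k A (ModuleCat.of k (N ⊗[k] A)) p : Type)).toLinearMap).comp <|
      (rhoBase k A ρN p).lTensor A

theorem coactMul_zero_tmul (a : A) (y : N) : coactMul k A ρN 0 (a ⊗ₜ y) =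
    (μA k A).lTensor N (TensorProduct.assoc k N A A (ρN y ⊗ₜ a)) :=
  rfl

theorem coactMul_succ_tmul (p : ℕ) (a : A) (x : Cd k A N p) (b : A) :
    coactMul k A ρN (p + 1) (a ⊗ₜ (x ⊗ₜ[k] b : Cd k A N p ⊗[k] A)) =
      (coactMul k A ρN p (a ⊗ₜ x) ⊗ₜ[k] b : Cd k A N (p + 1) ⊗[k] A) :=
  rfl

theorem coactMul_succ (p : ℕ) :
    (coactMul k A ρN (p + 1) : A ⊗[k] (Cd k A N p ⊗[k] A) →ₗ[k] Cd k A N (p + 1) ⊗[k] A) =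
      ((coactMul k A ρN p).rTensor A).comp
        (TensorProduct.assoc k A (Cd k A N p) A).symm.toLinearMap :=
  eq_rTensor_assoc_symm (coactMul_succ_tmul k A ρN p)

theorem coactMul_succ_apply (p : ℕ) (x : A ⊗[k] (Cd k A N p ⊗[k] A)) :
    coactMul k A ρN (p + 1) x =
      (coactMul k A ρN p).rTensor A ((TensorProduct.assoc k A (Cd k A N p) A).symm x) :=
  LinearMap.congr_fun (coactMul_succ k A ρN p) x

theorem comulAt_coactMul {j : ℕ} (hj : 2 ≤ j) : ∀ {p : ℕ}, j ≤ p + 1 → ∀ x : A ⊗[k] Cd k A N p,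
    comulAt k A (p + 1) j (coactMul k A ρN p x) =
      coactMul k A ρN (p + 1) ((comulAt k A p (j - 1)).lTensor A x)
  | 0, h, _ => by omega
  | p + 1, h, x => by
    rcases Nat.lt_or_ge j (p + 2) with hj' | hj'
    · exact Eq.trans ((comulAt_succ_apply k A (by omega) _).trans
          (congrArg ((comulAt k A (p + 1) j).rTensor A) (coactMul_succ_apply k A ρN p x))) <|
        Eq.trans (rTensor_rTensor_congr (comulAt_coactMul hj (by omega)) _) <|
        Eq.trans (congrArg ((coactMul k A ρN (p + 1)).rTensor A)
          (assoc_symm_lTensor_rTensor (comulAt k A p (j - 1)) x).symm) <|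
        Eq.trans ((coactMul_succ_apply k A ρN (p + 1) _).symm) <|
        congrArg (fun f : Cd k A N p ⊗[k] A →ₗ[k] Cd k A N (p + 1) ⊗[k] A =>
          coactMul k A ρN (p + 2) (f.lTensor A x)) (comulAt_succ k A (by omega)).symm
    · obtain rfl : j = p + 2 := by omega
      exact Eq.trans ((comulAt_last_apply k A (p + 1) _).trans (congrArg
          (fun y => (TensorProduct.assoc k (Cd k A N (p + 1)) A A).symm
            ((ΔA k A).lTensor _ y)) (coactMul_succ_apply k A ρN p x))) <|
        Eq.trans (comul_last_rTensor _ _) <|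
        Eq.trans (congrArg (((coactMul k A ρN p).rTensor A).rTensor A) (comul_last_assoc_symm x)) <|
        Eq.trans ((LinearMap.rTensor_comp_apply _ _ _ _).symm) <|
        Eq.trans (congr (congrArg (fun f : A ⊗[k] (Cd k A N p ⊗[k] A) →ₗ[k] Cd k A N (p + 1) ⊗[k] A =>
            ⇑(f.rTensor A)) (coactMul_succ k A ρN p).symm)
          (congrArg (fun f : Cd k A N p ⊗[k] A →ₗ[k] (Cd k A N p ⊗[k] A) ⊗[k] A =>
            (TensorProduct.assoc k A (Cd k A N p ⊗[k] A) A).symm (f.lTensor A x))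
            (comulAt_last k A p).symm)) <|
        (coactMul_succ_apply k A ρN (p + 1) _).symm

variable {ρN}

theorem comulAt_one_coactMul (hρ : CoassocR k A ρN) : ∀ (p : ℕ) (x : A ⊗[k] Cd k A N p),
    comulAt k A (p + 1) 1 (coactMul k A ρN p x) =
      coactMul k A ρN (p + 1) ((coactMul k A ρN p).lTensor A
        (TensorProduct.assoc k A A (Cd k A N p) ((ΔA k A).rTensor (Cd k A N p) x)))
  | 0, x => (comulAt_last_apply k A 0 _).trans <|
      (hρ.comul_mul (coactMul_zero_tmul k A ρN) x).trans
        (coactMul_succ_apply k A ρN 0 _).symm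
  | p + 1, x =>
    Eq.trans ((comulAt_succ_apply k A (by omega) _).trans
        (congrArg ((comulAt k A (p + 1) 1).rTensor A) (coactMul_succ_apply k A ρN p x))) <|
      Eq.trans (rTensor_rTensor_congr (comulAt_one_coactMul hρ p) _) <|
      rTensor_comul_assoc_symm (coactMul_succ_tmul k A ρN p)
        (coactMul_succ_tmul k A ρN (p + 1)) x

end Cofaces

section Relations

variable {M N : Type} [AddCommGroup M] [Module k M] [AddCommGroup N] [Module k N]
variable (ρM : M →ₗ[k] M ⊗[k] A) (ρN : N →ₗ[k] N ⊗[k] A) {n p : ℕ} (f : Yc k A M N n p)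

/-- The left coaction `Σ (a^1)_1 ⋯ (a^n)_1 ⊗ ((a^1)_2 ⊗ ⋯ ⊗ (a^n)_2 ⊗ m)` on `A^{⊗ n} ⊗ M`. -/
def coactL (n : ℕ) : Dm k A M n →ₗ[k] A ⊗[k] Dm k A M n :=
  (TensorProduct.assoc k A (Pk k A n : Type) M).toLinearMap.comp ((dL k A n).rTensor M)

theorem cof0YD_eq : cof0YD k A ρN n p f =
    (coactMul k A ρN p).comp ((f.lTensor A).comp (coactL k A n)) := by
  have : TensorProduct.map (LinearMap.id : A →ₗ[k] A) ((rhoBase k A ρN p).comp f) =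
      ((rhoBase k A ρN p).lTensor A).comp (f.lTensor A) := LinearMap.lTensor_comp _ _ _
  rw [cof0YD, this]
  rfl

theorem cofLast_eq : cofLast k A ρM n p f =
    (f.rTensor A).comp (tensorR k A (dR k A n) ρM) := by
  have : TensorProduct.map f (μA k A) =
      (f.rTensor A).comp (TensorProduct.map LinearMap.id (μA k A)) := by
    ext
    simp
  rw [cofLast, this]
  rfl

variable {ρM ρN}

theorem comulAt_cof0YD {j : ℕ} (hj : 2 ≤ j) (h : j ≤ p + 1) :
    (comulAt k A (p + 1) j).comp (cof0YD k A ρN n p f) =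
      cof0YD k A ρN n (p + 1) ((comulAt k A p (j - 1)).comp f) := by
  rw [cof0YD_eq, cof0YD_eq, LinearMap.lTensor_comp]
  exact LinearMap.ext fun x => comulAt_coactMul k A ρN hj h _

theorem comulAt_one_cof0YD (hρ : CoassocR k A ρN) :
    (comulAt k A (p + 1) 1).comp (cof0YD k A ρN n p f) =
      cof0YD k A ρN n (p + 1) (cof0YD k A ρN n p f) := by
  rw [cof0YD_eq, cof0YD_eq, LinearMap.lTensor_comp, LinearMap.lTensor_comp]
  have hL : CoassocL k A (coactL k A n (M := M)) := (coassocL_dL k A n).assoc_rTensor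
  exact LinearMap.ext fun x => (comulAt_one_coactMul k A hρ p _).trans <|
    congrArg (fun y => coactMul k A ρN (p + 1) ((coactMul k A ρN p).lTensor A y)) <|
      (assoc_comul_lTensor f _).trans (congrArg ((f.lTensor A).lTensor A) (hL x).symm)

theorem cofLast_cof0YD :
    cofLast k A ρM n (p + 1) (cof0YD k A ρN n p f) =
      cof0YD k A ρN n (p + 1) (cofLast k A ρM n p f) := by
  have hLR : Cocommute k A (coactL k A n) (tensorR k A (dR k A n) ρM) :=
    (cocommute_dL_dR k A n).assoc_rTensor
  have h₁ : (cof0YD k A ρN n p f).rTensor A = ((coactMul k A ρN p).rTensor A).comp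
      (((f.lTensor A).rTensor A).comp ((coactL k A n).rTensor A)) := by
    rw [cof0YD_eq, LinearMap.rTensor_comp, LinearMap.rTensor_comp]
  have h₂ : (cofLast k A ρM n p f).lTensor A =
      ((f.rTensor A).lTensor A).comp ((tensorR k A (dR k A n) ρM).lTensor A) := by
    rw [cofLast_eq]
    exact LinearMap.lTensor_comp _ _ _
  rw [cofLast_eq k A ρM (cof0YD k A ρN n p f), cof0YD_eq k A ρN (cofLast k A ρM n p f), h₁, h₂]
  exact LinearMap.ext fun x => Eq.trans
    (congrArg ((coactMul k A ρN p).rTensor A) <|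
      (congrArg ((f.lTensor A).rTensor A) (hLR x)).trans
        (assoc_symm_lTensor_rTensor f _).symm)
    (coactMul_succ_apply k A ρN p _).symm

theorem cofLast_comulAt {i : ℕ} (h : i ≤ p) :
    cofLast k A ρM n (p + 1) ((comulAt k A p i).comp f) =
      (comulAt k A (p + 1) i).comp (cofLast k A ρM n p f) := by
  rw [cofLast_eq, cofLast_eq, LinearMap.rTensor_comp]
  exact LinearMap.ext fun x => (comulAt_succ_apply k A (by omega) _).symm

theorem cofLast_cofLast (hρ : CoassocR k A ρM) :
    cofLast k A ρM n (p + 1) (cofLast k A ρM n p f) =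
      (comulAt k A (p + 1) (p + 1)).comp (cofLast k A ρM n p f) := by
  have hR : CoassocR k A (tensorR k A (dR k A n) ρM) := (coassocR_dR k A n).tensor hρ
  have h : ((f.rTensor A).comp (tensorR k A (dR k A n) ρM)).rTensor A =
      ((f.rTensor A).rTensor A).comp ((tensorR k A (dR k A n) ρM).rTensor A) :=
    LinearMap.rTensor_comp _ _ _
  rw [cofLast_eq, cofLast_eq]
  refine LinearMap.ext fun x => (LinearMap.congr_fun h _).trans ?_
  exact Eq.trans
    ((congrArg ((f.rTensor A).rTensor A) (hR x)).trans (comul_last_rTensor f _).symm)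
    (comulAt_last_apply k A p _).symm

theorem cYD_cYD (hM : CoassocR k A ρM) (hN : CoassocR k A ρN) {i j : ℕ} (hij : i < j)
    (hj : j ≤ p + 2) :
    cYD k A ρM ρN n (p + 1) j (cYD k A ρM ρN n p i f) =
      cYD k A ρM ρN n (p + 1) i (cYD k A ρM ρN n p (j - 1) f) := by
  have hj₀ : j ≠ 0 := by omega
  rcases Nat.eq_zero_or_pos i with rfl | hi
  · rcases Nat.lt_or_ge (p + 1) j with h | h
    · obtain rfl : j = p + 2 := by omega
      simpa [cYD] using cofLast_cof0YD k A f
    · rcases Nat.lt_or_ge 1 j with h₁ | h₁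
      · have h₂ : j - 1 ≠ 0 := by omega
        have h₃ : j - 1 ≤ p := by omega
        simpa only [cYD, if_true, if_pos h, if_pos h₃, if_neg hj₀, if_neg h₂]
          using comulAt_cof0YD k A f h₁ h
      · obtain rfl : j = 1 := by omega
        simpa [cYD] using comulAt_one_cof0YD k A f hN
  · have hi₀ : i ≠ 0 := by omega
    have hi₁ : i ≤ p + 1 := by omega
    have hj₁ : j - 1 ≠ 0 := by omega
    simp only [cYD, if_neg hj₀, if_neg hi₀, if_neg hj₁, if_pos hi₁]
    rcases Nat.lt_or_ge (p + 1) j with h | h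
    · rw [if_neg (by omega : ¬ j ≤ p + 1), if_neg (by omega : ¬ j - 1 ≤ p)]
      split_ifs with h'
      · exact cofLast_comulAt k A f h'
      · obtain rfl : i = p + 1 := by omega
        exact cofLast_cofLast k A f hM
    · rw [if_pos h, if_pos (by omega : i ≤ p), if_pos (by omega : j - 1 ≤ p)]
      exact LinearMap.ext fun x => comulAt_comulAt k A hi hij h (f x)

end Relations

/-- The alternating double sum attached to the cosimplicial relations vanishes. -/
theorem sum_alternating_eq_zero {V : Type} [AddCommGroup V] (m : ℕ) (g : ℕ → ℕ → V)
    (h : ∀ i j, i < j → j ≤ m → g j i = g i (j - 1)) :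
    ∑ j ∈ Finset.range (m + 1), ∑ i ∈ Finset.range m, ((-1 : ℤ) ^ (j + i)) • g j i = 0 := by
  rw [← Finset.sum_product']
  refine Finset.sum_involution
    (fun x _ => if x.2 < x.1 then (x.2, x.1 - 1) else (x.2 + 1, x.1)) ?_ ?_ ?_ ?_
  · rintro ⟨j, i⟩ hx
    simp only [Finset.mem_product, Finset.mem_range] at hx
    dsimp only
    split_ifs with hij
    · rw [h i j hij (by omega), (by omega : j + i = i + (j - 1) + 1), pow_succ]
      simp
    · rw [h j (i + 1) (by omega) (by omega), Nat.add_sub_cancel,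
        (by omega : i + 1 + j = j + i + 1), pow_succ]
      simp
  · rintro ⟨j, i⟩ hx -
    dsimp only
    split_ifs with hij <;> simp only [ne_eq, Prod.mk.injEq] <;> omega
  · rintro ⟨j, i⟩ hx
    simp only [Finset.mem_product, Finset.mem_range] at hx ⊢
    split_ifs <;> dsimp only <;> omega
  · rintro ⟨j, i⟩ hx
    by_cases hij : i < j
    · have h₁ : ¬ j - 1 < i := by omega
      have h₂ : j - 1 + 1 = j := by omega
      simp [hij, h₁, h₂]
    · have h₁ : j < i + 1 := by omega
      simp [hij, h₁]

section Linearity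

variable {M N : Type} [AddCommGroup M] [Module k M] [AddCommGroup N] [Module k N]
variable (ρM : M →ₗ[k] M ⊗[k] A) (ρN : N →ₗ[k] N ⊗[k] A)

theorem cYD_add (n p j : ℕ) (f g : Yc k A M N n p) : cYD k A ρM ρN n p j (f + g) =
    cYD k A ρM ρN n p j f + cYD k A ρM ρN n p j g := by
  simp only [cYD]
  split_ifs
  · simp only [cof0YD_eq, LinearMap.lTensor_add, LinearMap.add_comp, LinearMap.comp_add]
  · exact LinearMap.comp_add _ _ _
  · simp only [cofLast_eq, LinearMap.rTensor_add, LinearMap.add_comp]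
    rfl

theorem cYD_sum_zsmul (n p j : ℕ) (s : Finset ℕ) (c : ℕ → ℤ) (g : ℕ → Yc k A M N n p) :
    cYD k A ρM ρN n p j (∑ i ∈ s, c i • g i) = ∑ i ∈ s, c i • cYD k A ρM ρN n p j (g i) := by
  let F : Yc k A M N n p →+ Yc k A M N n (p + 1) :=
    AddMonoidHom.mk' (cYD k A ρM ρN n p j) (cYD_add k A ρM ρN n p j)
  change F _ = ∑ i ∈ s, c i • F (g i)
  simp only [map_sum, map_zsmul]

end Linearity

/-- The cosimplicial relations for the vertical coface maps of the
Yetter-Drinfel'd bicomplex, `c_j^{n,p+1} ∘ c_i^{n,p} = c_i^{n,p+1} ∘ c_{j-1}^{n,p}` for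
`0 ≤ i < j ≤ p+2`, and the consequence `d_c^{n,p+1} ∘ d_c^{n,p} = 0`. -/
theorem cYD_comp_rel_and_dcYD_dcYD (k : Type) [Field k] (A : Type) [Ring A] [Bialgebra k A]
    (M N : Type) [AddCommGroup M] [Module k M] [AddCommGroup N] [Module k N]
    (ωM : A ⊗[k] M →ₗ[k] M) (ρM : M →ₗ[k] M ⊗[k] A)
    (ωN : A ⊗[k] N →ₗ[k] N) (ρN : N →ₗ[k] N ⊗[k] A)
    (hM : IsYetterDrinfeld k A ωM ρM) (hN : IsYetterDrinfeld k A ωN ρN) :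
    (∀ (n p i j : ℕ), i < j → j ≤ p + 2 → ∀ f : Yc k A M N n p,
      cYD k A ρM ρN n (p+1) j (cYD k A ρM ρN n p i f) =
        cYD k A ρM ρN n (p+1) i (cYD k A ρM ρN n p (j-1) f)) ∧
    (∀ (n p : ℕ) (f : Yc k A M N n p),
      dcYD k A ρM ρN n (p+1) (dcYD k A ρM ρN n p f) = 0) := by
  have hM' : CoassocR k A ρM := LinearMap.congr_fun hM.2.1.2
  have hN' : CoassocR k A ρN := LinearMap.congr_fun hN.2.1.2
  refine ⟨fun n p i j hij hj f => cYD_cYD k A f hM' hN' hij hj, fun n p f => ?_⟩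
  rw [dcYD, dcYD]
  simp only [cYD_sum_zsmul, Finset.smul_sum, smul_smul, ← pow_add]
  exact sum_alternating_eq_zero (p + 2) (fun j i => cYD k A ρM ρN n (p + 1) j (cYD k A ρM ρN n p i f))
    fun i j hij hj => cYD_cYD k A f hM' hN' hij hj

end PS
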